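/- arXiv:2403.06781 — 2 statements merged into one kernel-verified Lean document; each statement's English description precedes it below -/
import Mathlib

section
/- Let (G,+) be a finite group (not necessarily abelian) whose smallest prime divisor of |G| is larger than t(2t+1), where t is a positive integer, and let M = [a_1^{λ_1}, a_2^{λ_2}] be a multiset of non-identity elements of G with λ_1 ≥ 2t. Then there exists a realization W = (w_0, …, w_{λ_1+λ_2}) of M such that: (a) −w_{i−1} + w_i = a_1 for all i ∈ {1,…,t}; (b) −w_{i−1} + w_i = a_1 for all i ∈ {λ_1+λ_2−(t−1), …, λ_1+λ_2}; and (c) w_i ≠ w_j whenever 1 ≤ |i−j| ≤ t. -/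
/-- `w : ℕ → G` (viewed as the walk `(w 0, w 1, …, w (Multiset.card M))`) is a
realization of the multiset `M` if `w 0 = 0` and there are signs
`ε₁, …, ε_ℓ ∈ {+1, -1}` such that the multiset
`[ε₁ • (-w₀ + w₁), …, ε_ℓ • (-w_{ℓ-1} + w_ℓ)]` equals `M` (where `ℓ = Multiset.card M`). -/
def IsRealization {G : Type*} [AddGroup G] (M : Multiset G) (w : ℕ → G) : Prop :=
  w 0 = 0 ∧ ∃ ε : ℕ → ℤˣ,
    (Multiset.range (Multiset.card M)).map
      (fun i => ((ε i : ℤ) • (-(w i) + w (i + 1)))) = M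

/-- A positive multiple `n • a` of a nonzero element cannot vanish when all prime divisors of
the group order exceed `n`. -/
theorem nsmul_ne_zero_of_lt_prime_divisors {G : Type*} [AddGroup G] [Fintype G] {N : ℕ}
    (hp : ∀ p : ℕ, p.Prime → p ∣ Fintype.card G → N < p) {a : G} (ha : a ≠ 0) {n : ℕ}
    (hn : 0 < n) (hnN : n ≤ N) : n • a ≠ 0 := by
  intro h
  have hone : addOrderOf a ≠ 1 := by rwa [Ne, AddMonoid.addOrderOf_eq_one_iff]
  have hlt := hp _ (Nat.minFac_prime hone) ((Nat.minFac_dvd _).trans addOrderOf_dvd_card)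
  have hle := Nat.le_of_dvd hn ((Nat.minFac_dvd _).trans (addOrderOf_dvd_of_nsmul_eq_zero h))
  omega

/-- For one of the two signs, no short nonnegative combination of `a` and `± b` vanishes. -/
theorem exists_sign_nsmul_add_nsmul_ne_zero {G : Type*} [AddGroup G] [Fintype G] {t N : ℕ}
    (hp : ∀ p : ℕ, p.Prime → p ∣ Fintype.card G → N < p) (htN : t ≤ N) (htt : t * t ≤ N)
    {a b : G} (ha : a ≠ 0) (hb : b ≠ 0) :
    ∃ u : ℤˣ, ∀ m n : ℕ, 0 < m + n → m + n ≤ t → m • a + n • ((u : ℤ) • b) ≠ 0 := by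
  by_contra! hcon
  obtain ⟨m, n, hpos, hle, h⟩ := hcon 1
  obtain ⟨m', n', hpos', hle', h'⟩ := hcon (-1)
  simp only [Units.val_one, one_zsmul, Units.val_neg, neg_zsmul] at h h'
  rw [_root_.neg_nsmul] at h'
  replace h : m • a = -(n • b) := eq_neg_of_add_eq_zero_left h
  replace h' : m' • a = n' • b := by simpa using eq_neg_of_add_eq_zero_left h'
  have hm : 0 < m := by
    rcases Nat.eq_zero_or_pos m with rfl | hm
    · refine absurd ?_ (nsmul_ne_zero_of_lt_prime_divisors hp hb (n := n) (by omega) (by omega))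
      simpa using h.symm
    · exact hm
  have hn' : 0 < n' := by
    rcases Nat.eq_zero_or_pos n' with rfl | hn'
    · refine absurd ?_ (nsmul_ne_zero_of_lt_prime_divisors hp ha (n := m') (by omega) (by omega))
      simpa using h'
    · exact hn'
  refine nsmul_ne_zero_of_lt_prime_divisors hp ha (n := n' * m + n * m') ?_ ?_ ?_
  · positivity
  · have := Nat.mul_le_mul hle hle'
    nlinarith [Nat.zero_le (m * m'), Nat.zero_le (n * n')]
  · rw [add_nsmul, mul_nsmul' a n' m, mul_nsmul' a n m', h, h', _root_.neg_nsmul, ← mul_nsmul',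
      ← mul_nsmul', mul_comm n n', neg_add_cancel]

/-- The walk that takes `t` steps `a`, then `l` steps `b`, and then only steps `a`. -/
def threeBlockWalk {G : Type*} [AddGroup G] (t l : ℕ) (a b : G) (i : ℕ) : G :=
  min i t • a + (min (i - t) l • b + (i - t - l) • a)

theorem threeBlockWalk_step_left {G : Type*} [AddGroup G] {t i : ℕ} (l : ℕ) (a b : G)
    (hi : i < t) : -threeBlockWalk t l a b i + threeBlockWalk t l a b (i + 1) = a := by
  have e₁ : min i t = i := by omega
  have e₂ : min (i + 1) t = i + 1 := by omega
  have e₃ : i - t = 0 := by omega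
  have e₄ : i + 1 - t = 0 := by omega
  simp [threeBlockWalk, e₁, e₂, e₃, e₄, succ_nsmul]

theorem threeBlockWalk_step_middle {G : Type*} [AddGroup G] {l i : ℕ} (t : ℕ) (a b : G)
    (hi : i < l) :
    -threeBlockWalk t l a b (t + i) + threeBlockWalk t l a b (t + i + 1) = b := by
  have e₁ : min (t + i) t = t := by omega
  have e₂ : min (t + i + 1) t = t := by omega
  have e₃ : t + i - t = i := by omega
  have e₄ : t + i + 1 - t = i + 1 := by omega
  have e₅ : min i l = i := by omega
  have e₆ : min (i + 1) l = i + 1 := by omega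
  have e₇ : i - l = 0 := by omega
  have e₈ : i + 1 - l = 0 := by omega
  simp only [threeBlockWalk, e₁, e₂, e₃, e₄, e₅, e₆, e₇, e₈]
  simp [succ_nsmul, add_assoc]

theorem threeBlockWalk_step_right {G : Type*} [AddGroup G] (t l i : ℕ) (a b : G) :
    -threeBlockWalk t l a b (t + l + i) + threeBlockWalk t l a b (t + l + i + 1) = a := by
  have e₁ : min (t + l + i) t = t := by omega
  have e₂ : min (t + l + i + 1) t = t := by omega
  have e₃ : min (t + l + i - t) l = l := by omega
  have e₄ : min (t + l + i + 1 - t) l = l := by omega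
  have e₅ : t + l + i - t - l = i := by omega
  have e₆ : t + l + i + 1 - t - l = i + 1 := by omega
  simp only [threeBlockWalk, e₁, e₂, e₃, e₄, e₅, e₆]
  simp [succ_nsmul, add_assoc]

/-- If no short combination of `a` and `b` vanishes, nearby vertices of the walk differ. -/
theorem threeBlockWalk_ne {G : Type*} [AddGroup G] {t l i j d : ℕ} {a b : G}
    (hab : ∀ m n : ℕ, 0 < m + n → m + n ≤ d → m • a + n • b ≠ 0)
    (hij : i < j) (hd : j - i ≤ d) :
    threeBlockWalk t l a b i ≠ threeBlockWalk t l a b j := by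
  intro h
  obtain ⟨p, hp⟩ : ∃ p, min j t = min i t + p := ⟨min j t - min i t, by omega⟩
  obtain ⟨q, hq⟩ : ∃ q, min (j - t) l = min (i - t) l + q :=
    ⟨min (j - t) l - min (i - t) l, by omega⟩
  obtain ⟨r, hr⟩ : ∃ r, j - t - l = r + (i - t - l) :=
    ⟨j - t - l - (i - t - l), by omega⟩
  have hsum : p + q + r = j - i := by omega
  simp only [threeBlockWalk, hp, hq, hr, add_nsmul, ← add_assoc, add_left_inj] at h
  simp only [add_assoc, add_right_inj] at h
  refine hab (r + p) q (by omega) (by omega) ?_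
  have key : p • a + (q • b + r • a) = 0 := by
    rcases Nat.eq_zero_or_pos (min (i - t) l) with h0 | h0
    · simpa [h0] using h.symm
    · have hp0 : p = 0 := by omega
      simpa [hp0] using h
  rw [← add_assoc] at key
  rw [add_nsmul, add_assoc, add_eq_zero_iff_eq_neg, ← neg_eq_iff_eq_neg]
  exact neg_eq_of_add_eq_zero_left key

/-- Up to the sign of `b`, the steps of the walk form the multiset `[a^(t+s), b^l]`. -/
theorem isRealization_threeBlockWalk {G : Type*} [AddGroup G] (t l s : ℕ) (a b : G) (u : ℤˣ) :
    IsRealization (Multiset.replicate (t + s) a + Multiset.replicate l b)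
      (threeBlockWalk t l a ((u : ℤ) • b)) := by
  refine ⟨by simp [threeBlockWalk], fun i => if t ≤ i ∧ i < t + l then u else 1, ?_⟩
  have hcard : Multiset.card (Multiset.replicate (t + s) a + Multiset.replicate l b) =
      t + l + s := by
    simp only [Multiset.card_add, Multiset.card_replicate]
    omega
  have hleft : ∀ i ∈ Multiset.range t,
      (((if t ≤ i ∧ i < t + l then u else 1 : ℤˣ) : ℤ) •
        (-threeBlockWalk t l a ((u : ℤ) • b) i + threeBlockWalk t l a ((u : ℤ) • b) (i + 1))) =
        a := by
    intro i hi
    rw [Multiset.mem_range] at hi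
    rw [threeBlockWalk_step_left _ _ _ hi, if_neg (by omega), Units.val_one, one_zsmul]
  have hmiddle : ∀ i ∈ Multiset.range l,
      (((if t ≤ t + i ∧ t + i < t + l then u else 1 : ℤˣ) : ℤ) •
        (-threeBlockWalk t l a ((u : ℤ) • b) (t + i) +
          threeBlockWalk t l a ((u : ℤ) • b) (t + i + 1))) = b := by
    intro i hi
    rw [Multiset.mem_range] at hi
    rw [threeBlockWalk_step_middle _ _ _ hi, if_pos (by omega), ← mul_zsmul,
      Int.units_coe_mul_self, one_zsmul]
  have hright : ∀ i ∈ Multiset.range s,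
      (((if t ≤ t + l + i ∧ t + l + i < t + l then u else 1 : ℤˣ) : ℤ) •
        (-threeBlockWalk t l a ((u : ℤ) • b) (t + l + i) +
          threeBlockWalk t l a ((u : ℤ) • b) (t + l + i + 1))) = a := by
    intro i _
    rw [threeBlockWalk_step_right, if_neg (by omega), Units.val_one, one_zsmul]
  rw [hcard, Multiset.range_add, Multiset.range_add]
  simp only [Multiset.map_add, Multiset.map_map, Function.comp_def]
  rw [Multiset.map_congr rfl hleft, Multiset.map_congr rfl hmiddle, Multiset.map_congr rfl hright]
  simp only [Multiset.map_const', Multiset.card_range, Multiset.replicate_add]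
  exact add_right_comm _ _ _

/-- If the smallest prime divisor of `|G|` is larger than `t(2t+1)`, then the
multiset `M = [a₁^{λ₁}, a₂^{λ₂}]` of non-identity elements with `λ₁ ≥ 2t` admits a
realization `W = (w₀, …, w_{λ₁+λ₂})` whose first `t` and last `t` steps are all
equal to `a₁`, and with `w_i ≠ w_j` whenever `1 ≤ |i - j| ≤ t`. -/
theorem two_element_weak_realization {G : Type*} [AddGroup G] [Fintype G]
    (t : ℕ) (ht : 0 < t)
    (hp : ∀ p : ℕ, p.Prime → p ∣ Fintype.card G → t * (2 * t + 1) < p)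
    (a₁ a₂ : G) (ha₁ : a₁ ≠ 0) (ha₂ : a₂ ≠ 0) (hne : a₁ ≠ a₂)
    (lam₁ lam₂ : ℕ) (h₁ : 2 * t ≤ lam₁) (h₂ : 1 ≤ lam₂) :
    ∃ w : ℕ → G,
      IsRealization (Multiset.replicate lam₁ a₁ + Multiset.replicate lam₂ a₂) w ∧
      (∀ i : ℕ, 1 ≤ i → i ≤ t → -(w (i - 1)) + w i = a₁) ∧
      (∀ i : ℕ, lam₁ + lam₂ - (t - 1) ≤ i → i ≤ lam₁ + lam₂ → -(w (i - 1)) + w i = a₁) ∧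
      (∀ i j : ℕ, i < j → j ≤ lam₁ + lam₂ → j - i ≤ t → w i ≠ w j) := by
  obtain ⟨s, rfl⟩ : ∃ s, lam₁ = t + s := ⟨lam₁ - t, by omega⟩
  have htt : t * t ≤ t * (2 * t + 1) := Nat.mul_le_mul_left t (by omega)
  have htN : t ≤ t * (2 * t + 1) := Nat.le_mul_of_pos_right t (by omega)
  obtain ⟨u, hu⟩ := exists_sign_nsmul_add_nsmul_ne_zero hp htN htt ha₁ ha₂
  refine ⟨threeBlockWalk t lam₂ a₁ ((u : ℤ) • a₂), isRealization_threeBlockWalk t lam₂ s a₁ a₂ u,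
    fun i hi hit => ?_, fun i hi _ => ?_, fun i j hij _ hd => threeBlockWalk_ne hu hij hd⟩
  · obtain ⟨k, rfl⟩ := Nat.exists_eq_add_of_le' hi
    exact threeBlockWalk_step_left _ _ _ hit
  · obtain ⟨k, rfl⟩ : ∃ k, i = t + lam₂ + k + 1 := ⟨i - 1 - (t + lam₂), by omega⟩
    exact threeBlockWalk_step_right _ _ _ _ _
end

section
/- For every positive integer t there exists a constant K(t) such that, for every group (G,+) (not necessarily abelian), every subset S of G ∖ {0} of size k ≥ K(t) is t-weakly sequenceable. -/
/-- A list `l = (y₁, …, y_m)` over an additive group is a `t`-weak ordering (of the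
multiset of its terms) if the partial sums `s_i = (l.take i).sum` satisfy
`s_i ≠ s_j` whenever `1 ≤ |i - j| ≤ t`. -/
def tWeakOrd {G : Type*} [AddGroup G] (t : ℕ) (l : List G) : Prop :=
  ∀ i j : ℕ, i < j → j ≤ l.length → j - i ≤ t →
    (l.take i).sum ≠ (l.take j).sum

/-- Every nonempty contiguous block of `l` of length at most `t` has nonzero sum. -/
def NoZeroBlock {G : Type*} [AddGroup G] (t : ℕ) (l : List G) : Prop :=
  ∀ w : List G, w <:+: l → w ≠ [] → w.length ≤ t → w.sum ≠ 0

/-- The elements `z` which make some block of length at most `t` ending at `z` sum to zero when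
`z` is appended to `l`. -/
def appendForbidden {G : Type*} [AddGroup G] [DecidableEq G] (t : ℕ) (l : List G) : Finset G :=
  (Finset.range t).image fun i => -(l.drop (l.length - i)).sum

/-- The elements `x` which make some block of length at most `t` through `x` sum to zero when
`x` is inserted between `u` and `v`. -/
def insertForbidden {G : Type*} [AddGroup G] [DecidableEq G] (t : ℕ) (u v : List G) : Finset G :=
  (Finset.range t ×ˢ Finset.range t).image fun ij =>
    -(u.drop (u.length - ij.1)).sum + -(v.take ij.2).sum

/-- Any `n` elements of `S` outside `p` can be worked into `p`, whatever list `r` follows `p`,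
without creating short blocks with zero sum. -/
def BlockAbsorbs {G : Type*} [AddGroup G] (t n : ℕ) (S : Finset G) (p : List G) : Prop :=
  ∀ r T : List G, NoZeroBlock t (p ++ r) → T.length = n → (∀ x ∈ T, x ∈ S ∧ x ∉ p) →
    ∃ p' : List G, p'.Perm (p ++ T) ∧ NoZeroBlock t (p' ++ r)

section

variable {G : Type*} [AddGroup G] {t : ℕ}

theorem NoZeroBlock.tWeakOrd {l : List G} (h : NoZeroBlock t l) : tWeakOrd t l := by
  intro i j hij hj hjt heq
  have hsplit : l.take i ++ (l.take j).drop i = l.take j := by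
    conv_rhs => rw [← List.take_append_drop i (l.take j)]
    rw [List.take_take, min_eq_left hij.le]
  have hlen : ((l.take j).drop i).length = j - i := by simp [hj]
  refine h ((l.take j).drop i)
    ((List.drop_suffix _ _).isInfix.trans (List.take_prefix _ _).isInfix) ?_ (by omega) ?_
  · rw [← List.length_pos_iff]; omega
  · rw [← hsplit, List.sum_append] at heq
    simpa using heq

theorem isInfix_append_cons {α : Type*} {w l₁ l₂ : List α} {x : α}
    (h : w <:+: l₁ ++ x :: l₂) :
    w <:+: l₁ ∨ w <:+: l₂ ∨ ∃ a b, w = a ++ x :: b ∧ a <:+ l₁ ∧ b <+: l₂ := by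
  obtain ⟨s, e, h⟩ := h
  rw [List.append_assoc, List.append_eq_append_iff] at h
  rcases h with ⟨a, ha, h⟩ | ⟨c, rfl, h⟩
  · rw [List.append_eq_append_iff] at h
    rcases h with ⟨d, hd, -⟩ | ⟨d, rfl, h⟩
    · exact Or.inl ⟨s, d, by simp [ha, hd]⟩
    · rcases List.cons_eq_append_iff.1 h with ⟨rfl, -⟩ | ⟨d', rfl, h⟩
      · exact Or.inl ⟨s, [], by simp [ha]⟩
      · exact Or.inr (Or.inr ⟨a, d', rfl, ⟨s, ha.symm⟩, ⟨e, (List.cons.inj h).2.symm⟩⟩)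
  · rcases List.append_eq_cons_iff.1 h.symm with ⟨rfl, h⟩ | ⟨d, rfl, h⟩
    · rcases w with _ | ⟨y, w⟩
      · exact Or.inl List.nil_infix
      · obtain ⟨rfl, hl⟩ := List.cons.inj (by simpa using h : x :: l₂ = y :: (w ++ e))
        exact Or.inr (Or.inr ⟨[], w, rfl, List.nil_suffix, ⟨e, hl.symm⟩⟩)
    · exact Or.inr (Or.inl ⟨d, e, by simpa using h.symm⟩)

theorem blockAbsorbs_zero (S : Finset G) (p : List G) : BlockAbsorbs t 0 S p := by
  intro r T h hT _
  obtain rfl := List.eq_nil_of_length_eq_zero hT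
  exact ⟨p, by simp, h⟩

variable [DecidableEq G]

theorem card_appendForbidden_le (l : List G) : (appendForbidden t l).card ≤ t :=
  Finset.card_image_le.trans (by simp)

theorem neg_sum_mem_appendForbidden {l s : List G} (hs : s <:+ l) (hlen : s.length < t) :
    -s.sum ∈ appendForbidden t l :=
  Finset.mem_image.2 ⟨s.length, Finset.mem_range.2 hlen, by
    rw [← List.suffix_iff_eq_drop.1 hs]⟩

theorem card_insertForbidden_le (u v : List G) : (insertForbidden t u v).card ≤ t * t :=
  Finset.card_image_le.trans (by simp)

theorem neg_sum_add_neg_sum_mem_insertForbidden {u v a b : List G} (ha : a <:+ u) (hb : b <+: v)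
    (hat : a.length < t) (hbt : b.length < t) :
    -a.sum + -b.sum ∈ insertForbidden t u v :=
  Finset.mem_image.2 ⟨(a.length, b.length), by simp [hat, hbt], by
    rw [← List.suffix_iff_eq_drop.1 ha, ← List.prefix_iff_eq_take.1 hb]⟩

theorem NoZeroBlock.append_singleton {l : List G} {z : G} (h : NoZeroBlock t l)
    (hz : z ∉ appendForbidden t l) : NoZeroBlock t (l ++ [z]) := by
  intro w hw hne hlen hsum
  rcases isInfix_append_cons hw with hw | hw | ⟨a, b, rfl, ha, hb⟩
  · exact h w hw hne hlen hsum
  · exact hne (by simpa using hw)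
  · obtain rfl : b = [] := by simpa using hb
    simp only [List.length_append, List.length_cons, List.length_nil] at hlen
    apply hz
    rw [eq_neg_of_add_eq_zero_right (a := a.sum) (b := z) (by simpa using hsum)]
    exact neg_sum_mem_appendForbidden ha (by omega)

theorem NoZeroBlock.append_pair {l : List G} {z b : G} (h : NoZeroBlock t l) (hb : b ≠ 0)
    (hz : z ∉ appendForbidden t l) (hzb : z ∉ (appendForbidden t l).image (· + -b)) :
    NoZeroBlock t (l ++ [z, b]) := by
  have h₁ := h.append_singleton hz
  intro w hw hne hlen hsum
  rw [List.append_cons] at hw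
  rcases isInfix_append_cons hw with hw | hw | ⟨a, c, rfl, ha, hc⟩
  · exact h₁ w hw hne hlen hsum
  · exact hne (by simpa using hw)
  · obtain rfl : c = [] := by simpa using hc
    rcases List.suffix_concat_iff.1 ha with rfl | ⟨s, rfl, hs⟩
    · exact hb (by simpa using hsum)
    · simp only [List.length_append, List.length_cons, List.length_nil] at hlen
      apply hzb
      refine Finset.mem_image.2 ⟨-s.sum, neg_sum_mem_appendForbidden hs (by omega), ?_⟩
      have hsum' : s.sum + z + b = 0 := by simpa [add_assoc] using hsum
      rw [← eq_neg_of_add_eq_zero_left hsum']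
      simp

theorem NoZeroBlock.insert_between {p u v r : List G} {x : G} (h : NoZeroBlock t (p ++ u ++ (v ++ r)))
    (hu : t ≤ u.length) (hv : t ≤ v.length) (hx : x ∉ insertForbidden t u v) :
    NoZeroBlock t (p ++ u ++ x :: (v ++ r)) := by
  intro w hw hne hlen hsum
  rcases isInfix_append_cons hw with hw | hw | ⟨a, b, rfl, ha, hb⟩
  · exact h w (hw.trans (List.prefix_append _ _).isInfix) hne hlen hsum
  · exact h w (hw.trans (List.suffix_append _ _).isInfix) hne hlen hsum
  · simp only [List.length_append, List.length_cons] at hlen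
    have hau := List.suffix_of_suffix_length_le ha (List.suffix_append p u) (by omega)
    have hbv := List.prefix_of_prefix_length_le hb (List.prefix_append v r) (by omega)
    apply hx
    have hsum' : a.sum + (x + b.sum) = 0 := by simpa using hsum
    rw [show x = -a.sum + -b.sum by
      rw [← eq_neg_of_add_eq_zero_right hsum']; simp]
    exact neg_sum_add_neg_sum_mem_insertForbidden hau hbv (by omega) (by omega)

theorem NoZeroBlock.exists_extend {S : Finset G} (n : ℕ) {l : List G} (h : NoZeroBlock t l)
    (hnd : l.Nodup) (hS : ∀ x ∈ l, x ∈ S) (hcard : l.length + n + t ≤ S.card) :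
    ∃ r : List G, r.length = n ∧ NoZeroBlock t (l ++ r) ∧ (l ++ r).Nodup ∧
      ∀ x ∈ l ++ r, x ∈ S := by
  induction n generalizing l with
  | zero => exact ⟨[], rfl, by simpa using h, by simpa using hnd, by simpa using hS⟩
  | succ n ih =>
    obtain ⟨z, hzS, hz⟩ : ∃ z ∈ S, z ∉ l.toFinset ∪ appendForbidden t l := by
      refine Finset.exists_mem_notMem_of_card_lt_card ?_
      have := Finset.card_union_le l.toFinset (appendForbidden t l)
      have := l.toFinset_card_le
      have := card_appendForbidden_le (t := t) l
      omega
    simp only [Finset.mem_union, List.mem_toFinset, not_or] at hz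
    obtain ⟨r, hr, h₁, h₂, h₃⟩ := ih (h.append_singleton hz.2)
      (by simpa [List.nodup_append, hnd] using fun a ha => ne_of_mem_of_not_mem ha hz.1)
      (by simpa [or_imp, forall_and, hzS] using hS) (by simp; omega)
    exact ⟨z :: r, by simp [hr], by simpa using h₁, by simpa using h₂, by simpa using h₃⟩

theorem NoZeroBlock.exists_extend_covering {S : Finset G} (h0 : ∀ x ∈ S, x ≠ 0) (B : List G)
    (hB : ∀ b ∈ B, b ∈ S) {l : List G} (h : NoZeroBlock t l) (hnd : l.Nodup)
    (hS : ∀ x ∈ l, x ∈ S) (hcard : l.length + 2 * B.length + 2 * t ≤ S.card) :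
    ∃ r : List G, r.length ≤ 2 * B.length ∧ NoZeroBlock t (l ++ r) ∧ (l ++ r).Nodup ∧
      (∀ x ∈ l ++ r, x ∈ S) ∧ ∀ b ∈ B, b ∈ l ++ r := by
  induction B generalizing l with
  | nil => exact ⟨[], by simp, by simpa using h, by simpa using hnd, by simpa using hS, by simp⟩
  | cons b B ih =>
    simp only [List.mem_cons, forall_eq_or_imp] at hB
    simp only [List.length_cons] at hcard
    by_cases hb : b ∈ l
    · obtain ⟨r, hr, h₁, h₂, h₃, h₄⟩ := ih hB.2 h hnd hS (by omega)
      refine ⟨r, by simp; omega, h₁, h₂, h₃, ?_⟩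
      simpa only [List.mem_cons, forall_eq_or_imp] using ⟨List.mem_append_left _ hb, h₄⟩
    · obtain ⟨z, hzS, hz⟩ : ∃ z ∈ S, z ∉ insert b l.toFinset ∪
          (appendForbidden t l ∪ (appendForbidden t l).image (· + -b)) := by
        refine Finset.exists_mem_notMem_of_card_lt_card ?_
        have := Finset.card_union_le (insert b l.toFinset)
          (appendForbidden t l ∪ (appendForbidden t l).image (· + -b))
        have := Finset.card_union_le (appendForbidden t l) ((appendForbidden t l).image (· + -b))
        have := Finset.card_image_le (s := appendForbidden t l) (f := (· + -b))
        have := Finset.card_insert_le b l.toFinset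
        have := l.toFinset_card_le
        have := card_appendForbidden_le (t := t) l
        omega
      rw [Finset.mem_union, Finset.mem_union, Finset.mem_insert, List.mem_toFinset] at hz
      push Not at hz
      obtain ⟨⟨hzb, hzl⟩, hz₁, hz₂⟩ := hz
      obtain ⟨r, hr, h₁, h₂, h₃, h₄⟩ := ih hB.2 (h.append_pair (h0 b hB.1) hz₁ hz₂)
        (by
          simp only [List.nodup_append, hnd, List.nodup_cons, List.mem_cons]
          grind)
        (by grind) (by simp; omega)
      rw [List.append_assoc] at h₁ h₂ h₃ h₄
      refine ⟨[z, b] ++ r, by simp; omega, h₁, h₂, h₃, ?_⟩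
      simpa only [List.mem_cons, forall_eq_or_imp] using ⟨by simp, h₄⟩

theorem BlockAbsorbs.succ {n : ℕ} {S : Finset G} {p u v b : List G} (hp : BlockAbsorbs t n S p)
    (hu : t ≤ u.length) (hv : t ≤ v.length)
    (hb : ∀ x ∈ insertForbidden t u v, x ∈ S → x ∈ p ++ u ++ v ++ b) :
    BlockAbsorbs t (n + 1) S (p ++ u ++ v ++ b) := by
  intro r T h hT hTS
  rcases T with _ | ⟨x, T⟩
  · simp at hT
  obtain ⟨p', hperm, h'⟩ := hp (u ++ v ++ b ++ r) T (by simpa using h) (by simpa using hT)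
    (fun y hy => ⟨(hTS y (by simp [hy])).1, fun hyp => (hTS y (by simp [hy])).2 (by simp [hyp])⟩)
  have hx := hTS x (by simp)
  refine ⟨p' ++ u ++ x :: (v ++ b), ?_, ?_⟩
  · rw [List.perm_iff_count] at hperm ⊢
    intro a
    have := hperm a
    simp only [List.count_append, List.count_cons] at this ⊢
    omega
  · have := NoZeroBlock.insert_between (p := p') (u := u) (v := v) (r := b ++ r) (x := x)
      (by simpa using h') hu hv (fun hmem => hx.2 (hb x hmem hx.1))
    simpa using this

theorem exists_blockAbsorbs {S : Finset G} (h0 : ∀ x ∈ S, x ≠ 0) (n : ℕ)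
    (hcard : n * (2 * t + 2 * (t * t)) + 2 * t ≤ S.card) :
    ∃ p : List G, p.length ≤ n * (2 * t + 2 * (t * t)) ∧ NoZeroBlock t p ∧ p.Nodup ∧
      (∀ x ∈ p, x ∈ S) ∧ BlockAbsorbs t n S p := by
  induction n with
  | zero =>
    exact ⟨[], by simp, fun w hw hne => absurd (by simpa using hw) hne, by simp, by simp,
      blockAbsorbs_zero S []⟩
  | succ n ih =>
    rw [add_mul, one_mul] at hcard ⊢
    obtain ⟨p, hlen, h, hnd, hS, hp⟩ := ih (by omega)
    obtain ⟨u, hu, h₁, hnd₁, hS₁⟩ := h.exists_extend t hnd hS (by omega)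
    obtain ⟨v, hv, h₂, hnd₂, hS₂⟩ := h₁.exists_extend t hnd₁ hS₁ (by simp; omega)
    have hBcard : (insertForbidden t u v ∩ S).toList.length ≤ t * t := by
      rw [Finset.length_toList]
      exact (Finset.card_le_card Finset.inter_subset_left).trans (card_insertForbidden_le u v)
    obtain ⟨b, hb, h₃, hnd₃, hS₃, hcov⟩ := h₂.exists_extend_covering h0
      (insertForbidden t u v ∩ S).toList (by simp) hnd₂ hS₂
      (by simp only [List.length_append]; omega)
    refine ⟨p ++ u ++ v ++ b, by simp only [List.length_append]; omega, h₃, hnd₃, hS₃,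
      hp.succ hu.ge hv.ge fun x hx hxS => hcov x (by simp [hx, hxS])⟩

end

/-- For every positive integer `t` there is `K` such that: in any group `G`, every
subset `S` of `G \ {0}` of size at least `K` is `t`-weakly sequenceable, i.e. admits
an ordering (each element appearing exactly once) which is a `t`-weak ordering. -/
theorem large_sets_weakly_sequenceable (t : ℕ) (ht : 0 < t) :
    ∃ K : ℕ, ∀ (G : Type*) [AddGroup G] (S : Finset G),
      (∀ x ∈ S, x ≠ (0 : G)) → K ≤ S.card →
      ∃ l : List G, (↑l : Multiset G) = S.val ∧ tWeakOrd t l := by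
  classical
  refine ⟨t * (2 * t + 2 * (t * t)) + 2 * t, fun G _ S h0 hcard => ?_⟩
  obtain ⟨p, hlen, h, hnd, hS, hp⟩ := exists_blockAbsorbs h0 t hcard
  obtain ⟨r, hr, h₁, hnd₁, hS₁⟩ :=
    h.exists_extend (S.card - t - p.length) hnd hS (by omega)
  have hsub : (p ++ r).toFinset ⊆ S := fun x hx => hS₁ x (by simpa using hx)
  obtain ⟨p', hperm, h₂⟩ := hp r (S \ (p ++ r).toFinset).toList h₁
    (by
      rw [Finset.length_toList, Finset.card_sdiff_of_subset hsub,
        List.toFinset_card_of_nodup hnd₁, List.length_append]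
      omega)
    (by simp +contextual)
  refine ⟨p' ++ r, ?_, h₂.tWeakOrd⟩
  rw [← Multiset.coe_add, Multiset.coe_eq_coe.2 hperm, ← Multiset.coe_add, Finset.coe_toList,
    add_right_comm, Multiset.coe_add, Finset.sdiff_val, List.toFinset_val, hnd₁.dedup]
  refine add_tsub_cancel_of_le ?_
  simpa only [← Finset.val_le_iff, List.toFinset_val, hnd₁.dedup] using hsub
end
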